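/- arXiv:2109.12874 — 3 statements merged into one kernel-verified Lean document; each statement's English description precedes it below -/
import Mathlib

section
/- Let p be an odd prime, ℓ ≥ 1 and τ ≥ 1 natural numbers, and let (a_0,b_0), (a_1,b_1), …, (a_ℓ,b_ℓ) be pairs of integers such that (a_1,b_1) is obtained from (a_0,b_0) by a root move and, for each 2 ≤ i ≤ ℓ, (a_i,b_i) is obtained from (a_{i−1},b_{i−1}) by an edge move. Assume that p does not divide a_0, p does not divide b_0, p^τ divides a_ℓ − b_ℓ, and p^τ does not divide a_j − b_j for any 0 ≤ j ≤ ℓ−1. Then for every natural number s < τ, the number of indices i with 1 ≤ i ≤ ℓ such that p^s divides a_i + b_i but p^{s+1} does not divide a_i + b_i equals the number of indices j with 0 ≤ j ≤ ℓ−1 such that p^s divides a_j − b_j but p^{s+1} does not divide a_j − b_j. -/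
open scoped Classical

/-- `(a',b')` is obtained from `(a,b)` by a *root move*: after possibly negating both
entries and/or swapping them, it equals one of `(a,-b)`, `(a-b,b)`, `(a,b-a)`. -/
def RootMove (p q : ℤ × ℤ) : Prop :=
  ∃ r : ℤ × ℤ,
    (r = q ∨ r = (-q.1, -q.2) ∨ r = (q.2, q.1) ∨ r = (-q.2, -q.1)) ∧
    (r = (p.1, -p.2) ∨ r = (p.1 - p.2, p.2) ∨ r = (p.1, p.2 - p.1))

/-- `(a',b')` is obtained from `(a,b)` by an *edge move*: after possibly negating both
entries and/or swapping them, it equals one of `(a-b,b)`, `(a,b-a)`. -/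
def EdgeMove (p q : ℤ × ℤ) : Prop :=
  ∃ r : ℤ × ℤ,
    (r = q ∨ r = (-q.1, -q.2) ∨ r = (q.2, q.1) ∨ r = (-q.2, -q.1)) ∧
    (r = (p.1 - p.2, p.2) ∨ r = (p.1, p.2 - p.1))

lemma EdgeMove.rootMove {q r : ℤ × ℤ} (h : EdgeMove q r) : RootMove q r := by
  obtain ⟨x, hx, h⟩ := h
  exact ⟨x, hx, Or.inr h⟩

/-- Up to signs, a root move exchanges the entries and the difference of the old pair for the
entries and the sum of the new one. -/
lemma RootMove.even_add_eq {f : ℤ → ℕ} (hf : ∀ x, f (-x) = f x) {q r : ℤ × ℤ}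
    (h : RootMove q r) :
    f q.1 + f q.2 + f (q.1 - q.2) = f r.1 + f r.2 + f (r.1 + r.2) := by
  obtain ⟨a, b⟩ := q
  obtain ⟨c, d⟩ := r
  obtain ⟨⟨x, y⟩, hx, h⟩ := h
  simp only [Prod.mk.injEq] at hx h
  have hsum : f c + f d + f (c + d) = f x + f y + f (x + y) := by
    rcases hx with ⟨rfl, rfl⟩ | ⟨rfl, rfl⟩ | ⟨rfl, rfl⟩ | ⟨rfl, rfl⟩
    · rfl
    · rw [hf, hf, ← neg_add, hf]
    · rw [add_comm x y]
      ring
    · rw [hf, hf, ← neg_add, hf, add_comm d c]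
      ring
  dsimp only
  rw [hsum]
  rcases h with ⟨rfl, rfl⟩ | ⟨rfl, rfl⟩ | ⟨rfl, rfl⟩
  · rw [hf, ← sub_eq_add_neg]
  · rw [sub_add_cancel]
    ring
  · rw [add_sub_cancel, ← hf (x - b), neg_sub]
    ring

lemma RootMove.dvd_of_dvd {n : ℤ} {q r : ℤ × ℤ} (h : RootMove q r)
    (h₁ : n ∣ r.1) (h₂ : n ∣ r.2) : n ∣ q.1 ∧ n ∣ q.2 := by
  obtain ⟨a, b⟩ := q
  obtain ⟨c, d⟩ := r
  obtain ⟨⟨x, y⟩, hx, h⟩ := h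
  simp only [Prod.mk.injEq] at hx h h₁ h₂ ⊢
  have hxy : n ∣ x ∧ n ∣ y := by
    rcases hx with ⟨rfl, rfl⟩ | ⟨rfl, rfl⟩ | ⟨rfl, rfl⟩ | ⟨rfl, rfl⟩ <;> simp [h₁, h₂]
  obtain ⟨hnx, hny⟩ := hxy
  rcases h with ⟨rfl, rfl⟩ | ⟨rfl, rfl⟩ | ⟨rfl, rfl⟩
  · exact ⟨hnx, dvd_neg.mp hny⟩
  · exact ⟨(dvd_sub_left hny).mp hnx, hny⟩
  · exact ⟨hnx, (dvd_sub_left hnx).mp hny⟩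

/-- The exchange of `RootMove.even_add_eq`, telescoped along a path of root moves. -/
lemma even_add_sum_eq_of_rootMove {f : ℤ → ℕ} (hf : ∀ x, f (-x) = f x) {a b : ℕ → ℤ} {n : ℕ}
    (h : ∀ i < n, RootMove (a i, b i) (a (i + 1), b (i + 1))) :
    f (a 0) + f (b 0) + ∑ i ∈ Finset.range n, f (a i - b i) =
      f (a n) + f (b n) + ∑ i ∈ Finset.range n, f (a (i + 1) + b (i + 1)) := by
  induction n with
  | zero => simp
  | succ n ih =>
    have hstep := (h n n.lt_succ_self).even_add_eq hf
    have hn := ih fun i hi => h i (hi.trans n.lt_succ_self)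
    rw [Finset.sum_range_succ, Finset.sum_range_succ]
    dsimp only at hstep
    lia

lemma dvd_of_dvd_of_rootMove {m : ℤ} {a b : ℕ → ℤ} {n : ℕ}
    (h : ∀ i < n, RootMove (a i, b i) (a (i + 1), b (i + 1)))
    (ha : m ∣ a n) (hb : m ∣ b n) : m ∣ a 0 ∧ m ∣ b 0 := by
  induction n with
  | zero => exact ⟨ha, hb⟩
  | succ n ih =>
    obtain ⟨ha', hb'⟩ := (h n n.lt_succ_self).dvd_of_dvd ha hb
    exact ih (fun i hi => h i (hi.trans n.lt_succ_self)) ha' hb'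

theorem stmt0 (p : ℕ) (hp : p.Prime) (hodd : Odd p) (ℓ τ : ℕ) (hℓ : 1 ≤ ℓ) (hτ : 1 ≤ τ)
    (a b : ℕ → ℤ)
    (hroot : RootMove (a 0, b 0) (a 1, b 1))
    (hedge : ∀ i, 2 ≤ i → i ≤ ℓ → EdgeMove (a (i - 1), b (i - 1)) (a i, b i))
    (ha0 : ¬ (p : ℤ) ∣ a 0) (hb0 : ¬ (p : ℤ) ∣ b 0)
    (hdvd : ((p : ℤ)) ^ τ ∣ a ℓ - b ℓ)
    (hnot : ∀ j < ℓ, ¬ ((p : ℤ)) ^ τ ∣ a j - b j) :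
    ∀ s < τ,
      ((Finset.Icc 1 ℓ).filter
          (fun i => ((p : ℤ)) ^ s ∣ a i + b i ∧ ¬ ((p : ℤ)) ^ (s + 1) ∣ a i + b i)).card =
      ((Finset.Icc 0 (ℓ - 1)).filter
          (fun j => ((p : ℤ)) ^ s ∣ a j - b j ∧ ¬ ((p : ℤ)) ^ (s + 1) ∣ a j - b j)).card := by
  intro s _
  have hmove : ∀ i < ℓ, RootMove (a i, b i) (a (i + 1), b (i + 1)) := by
    rintro (_ | i) hi
    · exact hroot
    · exact (hedge (i + 2) (by lia) (by lia)).rootMove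
  have hpd : (p : ℤ) ∣ a ℓ - b ℓ := (dvd_pow_self _ (by lia)).trans hdvd
  have ha : ¬ (p : ℤ) ∣ a ℓ := fun h =>
    ha0 (dvd_of_dvd_of_rootMove hmove h ((dvd_sub_right h).mp hpd)).1
  have hb : ¬ (p : ℤ) ∣ b ℓ := fun h => ha ((dvd_sub_left h).mp hpd)
  let f : ℤ → ℕ := fun x => if (p : ℤ) ^ s ∣ x ∧ ¬ (p : ℤ) ^ (s + 1) ∣ x then 1 else 0
  have hf : ∀ x, f (-x) = f x := fun x => by simp only [f, dvd_neg]
  have hunit : ∀ x, ¬ (p : ℤ) ∣ x → f x = if s = 0 then 1 else 0 := by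
    intro x hx
    rcases Nat.eq_zero_or_pos s with rfl | hs
    · simp [f, hx]
    · have : ¬ (p : ℤ) ^ s ∣ x := fun h => hx ((dvd_pow_self _ hs.ne').trans h)
      simp [f, this, hs.ne']
  have hsum := even_add_sum_eq_of_rootMove hf hmove
  rw [hunit _ ha0, hunit _ hb0, hunit _ ha, hunit _ hb, add_right_inj] at hsum
  have hIcc : Finset.Icc 0 (ℓ - 1) = Finset.range ℓ := by
    ext j
    simp only [Finset.mem_Icc, Finset.mem_range]
    lia
  have hIcc' : Finset.Icc 1 ℓ = (Finset.range ℓ).image (· + 1) := by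
    ext j
    simp only [Finset.mem_Icc, Finset.mem_image, Finset.mem_range]
    exact ⟨fun h => ⟨j - 1, by lia, by lia⟩, fun ⟨i, hi, h⟩ => by lia⟩
  rw [Finset.card_filter, Finset.card_filter, hIcc, hIcc',
    Finset.sum_image fun i _ j _ h => Nat.succ_injective h]
  exact hsum.symm
end

section
/- Let d be a positive integer, L ≥ 0, and let (a_0,b_0), (a_1,b_1), …, (a_L,b_L) be pairs of integers such that for each 1 ≤ i ≤ L, (a_i,b_i) is obtained from (a_{i−1},b_{i−1}) by a root move. Assume that d does not divide a_j − b_j for any 0 ≤ j ≤ L−1. If d divides a_L or d divides b_L, then d divides a_0 or d divides b_0. -/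
/-- A root move to a pair with an entry divisible by `d` starts from a pair `(a, b)` such that
`d` divides `a`, `b` or `a - b`. -/
theorem RootMove.dvd_or_dvd_or_dvd_sub {d : ℤ} {p q : ℤ × ℤ} (h : RootMove p q)
    (hq : d ∣ q.1 ∨ d ∣ q.2) : d ∣ p.1 ∨ d ∣ p.2 ∨ d ∣ p.1 - p.2 := by
  obtain ⟨r, hrq, hrp⟩ := h
  have hr : d ∣ r.1 ∨ d ∣ r.2 := by
    rcases hrq with rfl | rfl | rfl | rfl <;> simpa [or_comm] using hq
  rcases hrp with rfl | rfl | rfl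
  · rw [dvd_neg] at hr
    tauto
  · tauto
  · rw [dvd_sub_comm] at hr
    tauto

theorem stmt1 (d : ℕ) (hd : 0 < d) (L : ℕ) (a b : ℕ → ℤ)
    (hmove : ∀ i, 1 ≤ i → i ≤ L → RootMove (a (i - 1), b (i - 1)) (a i, b i))
    (hnd : ∀ j < L, ¬ (d : ℤ) ∣ a j - b j)
    (hL : (d : ℤ) ∣ a L ∨ (d : ℤ) ∣ b L) :
    (d : ℤ) ∣ a 0 ∨ (d : ℤ) ∣ b 0 := by
  induction L with
  | zero => exact hL
  | succ n ih =>
    refine ih (fun i h₁ h₂ => hmove i h₁ (by omega)) (fun j hj => hnd j (by omega)) ?_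
    have hstep : RootMove (a n, b n) (a (n + 1), b (n + 1)) := hmove (n + 1) (by omega) le_rfl
    have hdvd := hstep.dvd_or_dvd_or_dvd_sub hL
    have hsub := hnd n n.lt_succ_self
    tauto
end

section
/- Let d be a positive integer, ℓ ≥ 1, and let (a_0,b_0), (a_1,b_1), …, (a_ℓ,b_ℓ) be pairs of integers such that for each 1 ≤ i ≤ ℓ, (a_i,b_i) is obtained from (a_{i−1},b_{i−1}) by a root move. Assume that d does not divide a_0, d does not divide b_0, and d does not divide a_j − b_j for any 0 ≤ j ≤ ℓ−1. Then for every 1 ≤ i ≤ ℓ, d does not divide a_i, d does not divide b_i, and d does not divide a_i + b_i. -/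
/-- A root move out of a pair whose entries and difference are not divisible by `d`
yields a pair whose entries and sum are not divisible by `d`. -/
theorem RootMove.not_dvd {d : ℤ} {p q : ℤ × ℤ} (h : RootMove p q)
    (h₁ : ¬ d ∣ p.1) (h₂ : ¬ d ∣ p.2) (h₃ : ¬ d ∣ p.1 - p.2) :
    ¬ d ∣ q.1 ∧ ¬ d ∣ q.2 ∧ ¬ d ∣ q.1 + q.2 := by
  obtain ⟨r, hq, hp⟩ := h
  have hr : ¬ d ∣ r.1 ∧ ¬ d ∣ r.2 ∧ ¬ d ∣ r.1 + r.2 := by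
    rcases hp with rfl | rfl | rfl
    · exact ⟨h₁, by simpa using h₂, by simpa [sub_eq_add_neg] using h₃⟩
    · exact ⟨h₃, h₂, by simpa using h₁⟩
    · exact ⟨h₁, by rwa [dvd_sub_comm], by simpa using h₂⟩
  have hneg : d ∣ -q.1 + -q.2 ↔ d ∣ q.1 + q.2 := by rw [← neg_add, dvd_neg]
  rcases hq with rfl | rfl | rfl | rfl
  · exact hr
  · simpa only [dvd_neg, hneg] using hr
  · exact ⟨hr.2.1, hr.1, by simpa only [add_comm] using hr.2.2⟩
  · simp only [dvd_neg, add_comm (-q.2), hneg] at hr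
    exact ⟨hr.2.1, hr.1, hr.2.2⟩

theorem stmt2 (d : ℕ) (hd : 0 < d) (ℓ : ℕ) (hℓ : 1 ≤ ℓ) (a b : ℕ → ℤ)
    (hmove : ∀ i, 1 ≤ i → i ≤ ℓ → RootMove (a (i - 1), b (i - 1)) (a i, b i))
    (ha0 : ¬ (d : ℤ) ∣ a 0) (hb0 : ¬ (d : ℤ) ∣ b 0)
    (hnd : ∀ j < ℓ, ¬ (d : ℤ) ∣ a j - b j) :
    ∀ i, 1 ≤ i → i ≤ ℓ →
      ¬ (d : ℤ) ∣ a i ∧ ¬ (d : ℤ) ∣ b i ∧ ¬ (d : ℤ) ∣ a i + b i := by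
  intro i hi
  induction i, hi using Nat.le_induction with
  | base =>
    intro h
    exact (hmove 1 le_rfl h).not_dvd ha0 hb0 (hnd 0 h)
  | succ n _ ih =>
    intro h
    obtain ⟨ha, hb, _⟩ := ih (Nat.le_of_succ_le h)
    exact (hmove (n + 1) n.succ_pos h).not_dvd ha hb (hnd n h)
end
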